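/- Let A = (V, E_R, E_W) be an annotation DAG that is reachable from the initial annotation DAG A_init = ({⊥}, ∅, ∅) by a nonempty finite sequence of forward annotation transitions. Then there exists a node v ∈ V such that (i) for every edge (v', r, v) ∈ E_R one has v' = last(r, E_W), and (ii) v has no outgoing edge in E_R ∪ E_W. -/

import Mathlib

namespace CRIL

/-- Process identifiers: finite lists of positive integers. -/
abbrev PID := List ℕ+

/-- Nodes of an annotation DAG: either ⊥ or a pair (p, n). -/
inductive ANode where
  | bot : ANode
  | node : PID → ℕ → ANode
deriving DecidableEq

/-- Labeled edges. -/
abbrev AEdge (R : Type) := ANode × R × ANode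

/-- Annotation DAGs, with the five defining conditions. -/
structure AnnDAG (R : Type) where
  V : Set ANode
  ER : Set (AEdge R)
  EW : Set (AEdge R)
  finV : V.Finite
  bot_mem : ANode.bot ∈ V
  down : ∀ p n, ANode.node p n ∈ V → ∀ n' ≤ n, ANode.node p n' ∈ V
  edges_sub : ∀ e ∈ ER ∪ EW, e.1 ∈ V ∧ e.2.2 ∈ V
  in_unique : ∀ v' v'' r v, (v', r, v) ∈ ER ∪ EW → (v'', r, v) ∈ ER ∪ EW → v' = v''
  disj : ER ∩ EW = ∅
  acyclic : ∀ v, ¬ Relation.TransGen (fun a b => ∃ r, (a, r, b) ∈ ER ∪ EW) v v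
  w_pred : ∀ v' r v, (v', r, v) ∈ EW → v' ≠ ANode.bot → ∃ v'', (v'', r, v') ∈ EW
  w_out_unique : ∀ v r v' v'', (v, r, v') ∈ EW → (v, r, v'') ∈ EW → v' = v''

-- `last(r, E_W)`: the final node of the unique maximal chain of `r`-labeled
-- `E_W`-edges starting at ⊥ (⊥ if there is no such edge).
open Classical in
noncomputable def lastN {R : Type} (EW : Set (AEdge R)) (r : R) : ANode :=
  if h : ∃! v, Relation.ReflTransGen (fun a b => (a, r, b) ∈ EW) ANode.bot v ∧
      ∀ w, (v, r, w) ∉ EW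
  then h.exists.choose
  else ANode.bot

/-- `max_p(V) + 1`: one plus the largest `n` with `(p,n) ∈ V` (0 if none). -/
noncomputable def maxpSucc (V : Set ANode) (p : PID) : ℕ :=
  sSup {m : ℕ | ∃ n, m = n + 1 ∧ ANode.node p n ∈ V}

/-- `max_p(V)` as an integer, −1 if no `(p,n) ∈ V`. -/
noncomputable def maxp (V : Set ANode) (p : PID) : ℤ :=
  (maxpSucc V p : ℤ) - 1

/-- Labels (p, Rd, Wt). -/
abbrev Label (R : Type) := PID × Set R × Set R

/-- Forward annotation transition A₁ ⇀(p,Rd,Wt) A₂. -/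
def Step {R : Type} (A₁ A₂ : AnnDAG R) (p : PID) (Rd Wt : Set R) : Prop :=
  A₂.V = A₁.V ∪ {ANode.node p (maxpSucc A₁.V p)} ∧
  A₂.ER = A₁.ER ∪
    {e | ∃ r ∈ Rd \ Wt, e = (lastN A₁.EW r, r, ANode.node p (maxpSucc A₁.V p))} ∧
  A₂.EW = A₁.EW ∪
    {e | ∃ r ∈ Wt, e = (lastN A₁.EW r, r, ANode.node p (maxpSucc A₁.V p))}

/-- Forward transition with some label. -/
def StepAny {R : Type} (A₁ A₂ : AnnDAG R) : Prop := ∃ p Rd Wt, Step A₁ A₂ p Rd Wt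

/-- Forward transition with some label in `O`. -/
def StepIn {R : Type} (O : Set (Label R)) (A₁ A₂ : AnnDAG R) : Prop :=
  ∃ l ∈ O, Step A₁ A₂ l.1 l.2.1 l.2.2

/-- The initial annotation DAG ({⊥}, ∅, ∅). -/
def Ainit (R : Type) : AnnDAG R where
  V := {ANode.bot}
  ER := ∅
  EW := ∅
  finV := Set.finite_singleton _
  bot_mem := rfl
  down := by intro p n h; simp at h
  edges_sub := by intro e he; simp at he
  in_unique := by intro v' v'' r v h; simp at h
  disj := by simp
  acyclic := by
    intro v h
    have hne : ∀ a b : ANode, ¬ ∃ r : R, (a, r, b) ∈ (∅ ∪ ∅ : Set (AEdge R)) := by simp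
    cases h with
    | single h' => exact hne _ _ h'
    | tail _ h' => exact hne _ _ h'
  w_pred := by intro v' r v h; simp at h
  w_out_unique := by intro v r v' v'' h; simp at h

/-- Signed labels: forward or underlined (backward). -/
inductive SLabel (R : Type) where
  | fwd : Label R → SLabel R
  | bwd : Label R → SLabel R

/-- `und`: forget the underline. -/
def und {R : Type} : SLabel R → Label R
  | .fwd a => a
  | .bwd a => a

/-- The underline-toggle. -/
def toggle {R : Type} : SLabel R → SLabel R
  | .fwd a => .bwd a
  | .bwd a => .fwd a

/-- Combined transitions: forward, or reversed forward. -/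
def CStep {R : Type} (A A' : AnnDAG R) : SLabel R → Prop
  | .fwd a => Step A A' a.1 a.2.1 a.2.2
  | .bwd a => Step A' A a.1 a.2.1 a.2.2

/-- Independence of signed labels: incomparable pids and disjoint read/write sets. -/
def indepLab {R : Type} (α β : SLabel R) : Prop :=
  ¬ (und α).1 <+: (und β).1 ∧ ¬ (und β).1 <+: (und α).1 ∧
  (und α).2.1 ∩ (und β).2.2 = ∅ ∧ (und β).2.1 ∩ (und α).2.2 = ∅

/-- `diff` of a combined transition. -/
def diff {R : Type} (A A' : AnnDAG R) (α : SLabel R) :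
    Set ANode × Set (AEdge R) × Set (AEdge R) :=
  match α with
  | .fwd _ => (A'.V \ A.V, A'.ER \ A.ER, A'.EW \ A.EW)
  | .bwd _ => (A.V \ A'.V, A.ER \ A'.ER, A.EW \ A'.EW)

/-- The underlying triple of an annotation DAG. -/
def triple {R : Type} (A : AnnDAG R) : Set ANode × Set (AEdge R) × Set (AEdge R) :=
  (A.V, A.ER, A.EW)

/-- The ⊙^α operation on triples. -/
def odot {R : Type} (α : SLabel R)
    (T Δ : Set ANode × Set (AEdge R) × Set (AEdge R)) :
    Set ANode × Set (AEdge R) × Set (AEdge R) :=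
  match α with
  | .fwd _ => (T.1 ∪ Δ.1, T.2.1 ∪ Δ.2.1, T.2.2 ∪ Δ.2.2)
  | .bwd _ => (T.1 \ Δ.1, T.2.1 \ Δ.2.1, T.2.2 \ Δ.2.2)


open Classical in
theorem lastN_congr {R : Type} {EW EW' : Set (AEdge R)} {r : R}
    (h : ∀ a b, (a, r, b) ∈ EW ↔ (a, r, b) ∈ EW') : lastN EW r = lastN EW' r := by
  have key : ∀ f g : ANode → ANode → Prop, f = g →
      (if h : ∃! v, Relation.ReflTransGen f ANode.bot v ∧ ∀ w, ¬ f v w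
        then h.exists.choose else ANode.bot) =
      (if h : ∃! v, Relation.ReflTransGen g ANode.bot v ∧ ∀ w, ¬ g v w
        then h.exists.choose else ANode.bot) := by
    rintro f _ rfl
    rfl
  exact key (fun a b => (a, r, b) ∈ EW) (fun a b => (a, r, b) ∈ EW')
    (funext₂ fun a b => propext (h a b))

theorem lastN_mem {R : Type} (A : AnnDAG R) (r : R) : lastN A.EW r ∈ A.V := by
  unfold lastN
  split_ifs with h
  · rcases Relation.ReflTransGen.cases_tail h.exists.choose_spec.1 with hb | ⟨c, -, hc⟩
    · rw [hb]
      exact A.bot_mem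
    · exact (A.edges_sub _ (Or.inr hc)).2
  · exact A.bot_mem

theorem node_maxpSucc_notMem {V : Set ANode} (hV : V.Finite) (p : PID) :
    ANode.node p (maxpSucc V p) ∉ V := by
  intro hmem
  have hfin : {n : ℕ | ANode.node p n ∈ V}.Finite :=
    hV.preimage fun a _ b _ hab => (ANode.node.inj hab).2
  have hbdd : BddAbove {m : ℕ | ∃ n, m = n + 1 ∧ ANode.node p n ∈ V} := by
    obtain ⟨B, hB⟩ := hfin.bddAbove
    refine ⟨B + 1, ?_⟩
    rintro m ⟨n, rfl, hn⟩
    exact Nat.succ_le_succ (hB hn)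
  have hle : maxpSucc V p + 1 ≤ maxpSucc V p := le_csSup hbdd ⟨_, rfl, hmem⟩
  omega

/-- any annotation DAG reachable from `Ainit` by a nonempty sequence of
forward transitions has a node all of whose incoming `E_R` edges come from
`last(r, E_W)` and which has no outgoing edge in `E_R ∪ E_W`. -/
theorem stmt0 {R : Type} (A : AnnDAG R)
    (h : Relation.TransGen (StepAny (R := R)) (Ainit R) A) :
    ∃ v ∈ A.V,
      (∀ v' r, (v', r, v) ∈ A.ER → v' = lastN A.EW r) ∧
      (∀ r w, (v, r, w) ∉ A.ER ∪ A.EW) := by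
  obtain ⟨A₁, -, p, Rd, Wt, hV, hER, hEW⟩ := Relation.TransGen.tail'_iff.1 h
  have hfresh := node_maxpSucc_notMem A₁.finV p
  refine ⟨ANode.node p (maxpSucc A₁.V p), by simp [hV], ?_, ?_⟩
  · intro v' r he
    rw [hER] at he
    rcases he with he | ⟨r', hr', he⟩
    · exact absurd (A₁.edges_sub _ (Or.inl he)).2 hfresh
    · simp only [Prod.mk.injEq] at he
      obtain ⟨rfl, rfl, -⟩ := he
      refine lastN_congr fun a b => ?_
      rw [hEW]
      refine ⟨Or.inl, ?_⟩
      rintro (hab | ⟨r', hW, hab⟩)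
      · exact hab
      · simp only [Prod.mk.injEq] at hab
        obtain ⟨-, rfl, -⟩ := hab
        exact absurd hW hr'.2
  · intro r w he
    rw [hER, hEW] at he
    rcases he with (he | ⟨r', -, he⟩) | (he | ⟨r', -, he⟩)
    · exact hfresh (A₁.edges_sub _ (Or.inl he)).1
    · exact hfresh ((Prod.mk.inj he).1 ▸ lastN_mem A₁ r')
    · exact hfresh (A₁.edges_sub _ (Or.inr he)).1
    · exact hfresh ((Prod.mk.inj he).1 ▸ lastN_mem A₁ r')

end CRIL
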